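/- arXiv:0706.0119 — 2 statements merged into one kernel-verified Lean document; each statement's English description precedes it below -/
import Mathlib

section
/- Let a > 0 and X ∈ ℝ with −√a < X < √a, and let 𝒫₁ = {(x,y,z) ∈ ℝ³ : x² + y² ≤ z, z ≤ a, x ≥ X}, with centroid (x₁, y₁, z₁) with respect to Lebesgue measure. Then z₁ = 2a/3 if and only if X = 0; moreover, when X = 0 the volume of 𝒫₁ equals a²π/4, i.e. half the volume a²π/2 of the full segment 𝒫 = {x² + y² ≤ z ≤ a}. -/
open Real MeasureTheory

/-- The planar parabolic segment `{(y, z) : c + y² ≤ z ≤ a}`. -/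
def parabolicSegment (c a : ℝ) : Set (ℝ × ℝ) := {q | c + q.1 ^ 2 ≤ q.2 ∧ q.2 ≤ a}

/-- The part `X ≤ x` of the paraboloid segment `{x² + y² ≤ z ≤ a}`. -/
def cutParaboloid (a X : ℝ) : Set (ℝ × ℝ × ℝ) :=
  {p | p.1 ^ 2 + p.2.1 ^ 2 ≤ p.2.2 ∧ p.2.2 ≤ a ∧ X ≤ p.1}

lemma isCompact_parabolicSegment (c a : ℝ) : IsCompact (parabolicSegment c a) := by
  refine (isCompact_Icc (a := ((-√(a - c), c) : ℝ × ℝ)) (b := (√(a - c), a))).of_isClosed_subset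
    ?_ ?_
  · simp only [parabolicSegment, Set.ofPred_and]
    exact (isClosed_le (by fun_prop) (by fun_prop)).inter
      (isClosed_le (by fun_prop) (by fun_prop))
  · rintro ⟨y, z⟩ ⟨h, h'⟩
    simp only at h h'
    have hy := abs_le.mp (Real.abs_le_sqrt (show y ^ 2 ≤ a - c by linarith))
    exact ⟨⟨hy.1, by simp only; nlinarith [sq_nonneg y]⟩, ⟨hy.2, h'⟩⟩

lemma isCompact_cutParaboloid (a X : ℝ) : IsCompact (cutParaboloid a X) := by
  refine (isCompact_Icc (a := ((-√a, -√a, 0) : ℝ × ℝ × ℝ)) (b := (√a, √a, a))).of_isClosed_subset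
    ?_ ?_
  · simp only [cutParaboloid, Set.ofPred_and]
    exact (isClosed_le (by fun_prop) (by fun_prop)).inter
      ((isClosed_le (by fun_prop) (by fun_prop)).inter (isClosed_le (by fun_prop) (by fun_prop)))
  · rintro ⟨x, y, z⟩ ⟨h, h', -⟩
    simp only at h h'
    have hx := abs_le.mp (Real.abs_le_sqrt (show x ^ 2 ≤ a by nlinarith [sq_nonneg y]))
    have hy := abs_le.mp (Real.abs_le_sqrt (show y ^ 2 ≤ a by nlinarith [sq_nonneg x]))
    exact ⟨⟨hx.1, hy.1, by simp only; nlinarith [sq_nonneg y, sq_nonneg x]⟩, ⟨hx.2, hy.2, h'⟩⟩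

lemma integral_linear_mul_sqrt {c a : ℝ} (hca : c ≤ a) (p r : ℝ) :
    ∫ z in c..a, (p * z + r) * (2 * √(z - c)) =
      4 / 3 * (p * c + r) * ((a - c) * √(a - c)) + 4 / 5 * p * ((a - c) ^ 2 * √(a - c)) := by
  have key := intervalIntegral.integral_eq_sub_of_hasDerivAt_of_le
    (f := fun z => 4 / 3 * (p * c + r) * ((z - c) * √(z - c)) + 4 / 5 * p * ((z - c) ^ 2 * √(z - c)))
    (f' := fun z => (p * z + r) * (2 * √(z - c))) hca (by fun_prop) ?_
    ((by fun_prop : Continuous _).intervalIntegrable _ _)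
  · rw [key]; simp
  · intro z hz
    have hpos : 0 < z - c := sub_pos.mpr hz.1
    have hw : HasDerivAt (fun z => z - c) 1 z := (hasDerivAt_id z).sub_const c
    have hs := hw.sqrt hpos.ne'
    have h := ((hw.mul hs).const_mul (4 / 3 * (p * c + r))).add
      (((hw.pow 2).mul hs).const_mul (4 / 5 * p))
    refine h.congr_deriv ?_
    have hsp : 0 < √(z - c) := Real.sqrt_pos.mpr hpos
    have hsq : z - c = √(z - c) ^ 2 := (Real.sq_sqrt hpos.le).symm
    obtain ⟨s, hs'⟩ : ∃ s, s = √(z - c) := ⟨_, rfl⟩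
    have hz' : z = c + s ^ 2 := by rw [hs']; linarith
    rw [← hs'] at hsp ⊢
    subst hz'
    simp
    field_simp
    ring

lemma setIntegral_parabolicSegment {c a : ℝ} (hca : c ≤ a) (p r : ℝ) :
    ∫ q in parabolicSegment c a, (p * q.2 + r) =
      4 / 3 * (p * c + r) * ((a - c) * √(a - c)) + 4 / 5 * p * ((a - c) ^ 2 * √(a - c)) := by
  have hc := isCompact_parabolicSegment c a
  have hint : IntegrableOn (fun q : ℝ × ℝ => p * q.2 + r) (parabolicSegment c a) :=
    (by fun_prop : Continuous _).continuousOn.integrableOn_compact hc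
  rw [← integral_linear_mul_sqrt hca, intervalIntegral.integral_of_le hca,
    ← integral_Icc_eq_integral_Ioc, ← integral_indicator hc.measurableSet,
    ← integral_indicator measurableSet_Icc, Measure.volume_eq_prod,
    integral_prod_symm _ (by
      rw [← Measure.volume_eq_prod]; exact hint.integrable_indicator hc.measurableSet)]
  congr 1 with z
  by_cases hz : z ∈ Set.Icc c a
  · have : (fun y => (parabolicSegment c a).indicator (fun q : ℝ × ℝ => p * q.2 + r) (y, z)) =
        (Set.Icc (-√(z - c)) (√(z - c))).indicator fun _ => p * z + r := by
      ext y
      have : (y, z) ∈ parabolicSegment c a ↔ y ∈ Set.Icc (-√(z - c)) (√(z - c)) := by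
        rw [Set.mem_Icc, ← Real.sq_le (sub_nonneg.mpr hz.1)]
        exact ⟨fun h => by have := h.1; simp only at this; linarith,
          fun h => ⟨by simp only; linarith, hz.2⟩⟩
      simp only [Set.indicator, this]
    rw [this, integral_indicator measurableSet_Icc, Set.indicator_of_mem hz, setIntegral_const,
      Real.volume_real_Icc_of_le (by linarith [Real.sqrt_nonneg (z - c)]), smul_eq_mul]
    ring
  · rw [Set.indicator_of_notMem hz]
    refine integral_eq_zero_of_ae (.of_forall fun y => Set.indicator_of_notMem ?_ _)
    rintro ⟨h, h'⟩
    exact hz ⟨by simp only at h; nlinarith [sq_nonneg y], h'⟩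

lemma setIntegral_cutParaboloid {a X : ℝ} (ha : 0 < a) (h1 : -√a < X) (h2 : X < √a) (p r : ℝ) :
    ∫ q in cutParaboloid a X, (p * q.2.2 + r) =
      ∫ x in X..√a, (4 / 3 * (p * x ^ 2 + r) * ((a - x ^ 2) * √(a - x ^ 2)) +
        4 / 5 * p * ((a - x ^ 2) ^ 2 * √(a - x ^ 2))) := by
  have hc := isCompact_cutParaboloid a X
  have hint : IntegrableOn (fun q : ℝ × ℝ × ℝ => p * q.2.2 + r) (cutParaboloid a X) :=
    (by fun_prop : Continuous _).continuousOn.integrableOn_compact hc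
  rw [intervalIntegral.integral_of_le h2.le, ← integral_Icc_eq_integral_Ioc,
    ← integral_indicator hc.measurableSet, ← integral_indicator measurableSet_Icc,
    Measure.volume_eq_prod, integral_prod _ (by
      rw [← Measure.volume_eq_prod]; exact hint.integrable_indicator hc.measurableSet)]
  congr 1 with x
  by_cases hx : x ∈ Set.Icc X √a
  · have hxa : x ^ 2 ≤ a := (Real.sq_le ha.le).mpr ⟨h1.le.trans hx.1, hx.2⟩
    rw [Set.indicator_of_mem hx, ← setIntegral_parabolicSegment hxa,
      ← integral_indicator (isCompact_parabolicSegment _ _).measurableSet]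
    congr 1 with q
    have : (x, q) ∈ cutParaboloid a X ↔ q ∈ parabolicSegment (x ^ 2) a :=
      ⟨fun h => ⟨h.1, h.2.1⟩, fun h => ⟨h.1, h.2, hx.1⟩⟩
    by_cases hq : q ∈ parabolicSegment (x ^ 2) a
    · rw [Set.indicator_of_mem hq, Set.indicator_of_mem (this.mpr hq)]
    · rw [Set.indicator_of_notMem hq, Set.indicator_of_notMem (mt this.mp hq)]
  · rw [Set.indicator_of_notMem hx]
    refine integral_eq_zero_of_ae (.of_forall fun q => Set.indicator_of_notMem ?_ _)
    rintro ⟨h, h', h''⟩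
    exact hx ⟨h'', Real.le_sqrt_of_sq_le (by simp only at h h'; nlinarith [sq_nonneg q.1])⟩

lemma hasDerivAt_const_sub_sq (a x : ℝ) :
    HasDerivAt (fun x => a - x ^ 2) (-(2 * x)) x := by
  simpa using (hasDerivAt_pow 2 x).const_sub a

lemma sub_sq_pos_of_lt_sqrt {a x : ℝ} (h1 : -√a < x) (h2 : x < √a) :
    0 < a - x ^ 2 :=
  sub_pos.mpr (Real.sq_lt.mpr ⟨h1, h2⟩)

lemma integral_moment_cutParaboloid {a X : ℝ} (ha : 0 < a) (h1 : -√a < X) (h2 : X < √a) :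
    ∫ q in cutParaboloid a X, (q.2.2 - 2 * a / 3) =
      4 / 45 * X * ((a - X ^ 2) ^ 2 * √(a - X ^ 2)) := by
  have h := setIntegral_cutParaboloid ha h1 h2 1 (-(2 * a / 3))
  simp only [one_mul, ← sub_eq_add_neg] at h
  rw [h, intervalIntegral.integral_eq_sub_of_hasDerivAt_of_le
    (f := fun x => -(4 / 45) * (x * ((a - x ^ 2) ^ 2 * √(a - x ^ 2)))) h2.le (by fun_prop) ?_
    ((by fun_prop : Continuous _).intervalIntegrable _ _)]
  · simp [Real.sq_sqrt ha.le]
    ring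
  · intro x hx
    have hpos := sub_sq_pos_of_lt_sqrt (h1.trans hx.1) hx.2
    have hw := hasDerivAt_const_sub_sq a x
    have h := ((hasDerivAt_id x).mul ((hw.pow 2).mul (hw.sqrt hpos.ne'))).const_mul (-(4 / 45))
    refine h.congr_deriv ?_
    have hsp : 0 < √(a - x ^ 2) := Real.sqrt_pos.mpr hpos
    have hsq : √(a - x ^ 2) ^ 2 = a - x ^ 2 := Real.sq_sqrt hpos.le
    obtain ⟨s, hs⟩ : ∃ s, s = √(a - x ^ 2) := ⟨_, rfl⟩
    rw [← hs] at hsp hsq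
    obtain rfl : a = x ^ 2 + s ^ 2 := by linarith
    simp
    simp only [add_sub_cancel_left] at hs
    rw [← hs]
    field_simp
    ring

lemma volume_real_cutParaboloid {a X : ℝ} (ha : 0 < a) (h1 : -√a < X) (h2 : X < √a) :
    volume.real (cutParaboloid a X) = ∫ x in X..√a, 4 / 3 * ((a - x ^ 2) * √(a - x ^ 2)) := by
  simpa using setIntegral_cutParaboloid ha h1 h2 0 1

lemma volume_real_cutParaboloid_pos {a X : ℝ} (ha : 0 < a) (h1 : -√a < X) (h2 : X < √a) :
    0 < volume.real (cutParaboloid a X) := by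
  rw [volume_real_cutParaboloid ha h1 h2]
  refine intervalIntegral.intervalIntegral_pos_of_pos_on
    ((by fun_prop : Continuous _).intervalIntegrable _ _) (fun x hx => ?_) h2
  have hpos := sub_sq_pos_of_lt_sqrt (h1.trans hx.1) hx.2
  have := Real.sqrt_pos.mpr hpos
  positivity

lemma volume_real_cutParaboloid_zero {a : ℝ} (ha : 0 < a) :
    volume.real (cutParaboloid a 0) = a ^ 2 * π / 4 := by
  have hsa := Real.sqrt_pos.mpr ha
  rw [volume_real_cutParaboloid ha (by linarith) hsa,
    intervalIntegral.integral_eq_sub_of_hasDerivAt_of_le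
    (f := fun x => 1 / 3 * (x * ((a - x ^ 2) * √(a - x ^ 2))) +
      a / 2 * (x * √(a - x ^ 2)) + a ^ 2 / 2 * Real.arcsin (x / √a)) hsa.le
    (by fun_prop) ?_ ((by fun_prop : Continuous _).intervalIntegrable _ _)]
  · simp [Real.sq_sqrt ha.le, div_self hsa.ne']
    ring
  · intro x hx
    have hpos := sub_sq_pos_of_lt_sqrt (by linarith [hx.1]) hx.2
    have hw := hasDerivAt_const_sub_sq a x
    have hs := hw.sqrt hpos.ne'
    have hlt : x / √a < 1 := (div_lt_one hsa).mpr hx.2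
    have hgt : 0 < x / √a := div_pos hx.1 hsa
    have harc := (Real.hasDerivAt_arcsin (by linarith) hlt.ne).comp x
      ((hasDerivAt_id x).div_const √a)
    have h := ((((hasDerivAt_id x).mul (hw.mul hs)).const_mul (1 / 3)).add
      (((hasDerivAt_id x).mul hs).const_mul (a / 2))).add (harc.const_mul (a ^ 2 / 2))
    refine h.congr_deriv ?_
    have hroot : √(1 - (x / √a) ^ 2) = √(a - x ^ 2) / √a := by
      rw [← Real.sqrt_div hpos.le, div_pow, Real.sq_sqrt ha.le]
      congr 1
      field_simp
    have hsp : 0 < √(a - x ^ 2) := Real.sqrt_pos.mpr hpos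
    have hsq : √(a - x ^ 2) ^ 2 = a - x ^ 2 := Real.sq_sqrt hpos.le
    simp only [id, hroot, Pi.mul_apply]
    obtain ⟨s, hs⟩ : ∃ s, s = √(a - x ^ 2) := ⟨_, rfl⟩
    rw [← hs] at hsp hsq ⊢
    have hax : a = x ^ 2 + s ^ 2 := by linarith
    have hinv : 1 / (s / √a) * (1 / √a) = 1 / s := by field_simp
    rw [hinv]
    clear hs
    subst hax
    field_simp
    ring

theorem stmt_18 (a X : ℝ) (ha : 0 < a)
    (h1 : -Real.sqrt a < X) (h2 : X < Real.sqrt a)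
    (P₁ : Set (ℝ × ℝ × ℝ))
    (hP₁ : P₁ = {p | p.1 ^ 2 + p.2.1 ^ 2 ≤ p.2.2 ∧ p.2.2 ≤ a ∧ X ≤ p.1})
    (B₁ : ℝ × ℝ × ℝ)
    (hB₁ : B₁ = ((volume P₁).toReal)⁻¹ • ∫ p in P₁, p) :
    (B₁.2.2 = 2 * a / 3 ↔ X = 0) ∧
    (X = 0 → (volume P₁).toReal = a ^ 2 * π / 4) := by
  obtain rfl : P₁ = cutParaboloid a X := hP₁
  have hc := isCompact_cutParaboloid a X
  have hint {E : Type} [NormedAddCommGroup E] {f : ℝ × ℝ × ℝ → E} (hf : Continuous f) :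
      Integrable f (volume.restrict (cutParaboloid a X)) := hf.continuousOn.integrableOn_compact hc
  refine ⟨?_, ?_⟩
  · have hV := volume_real_cutParaboloid_pos ha h1 h2
    have hM := integral_moment_cutParaboloid ha h1 h2
    have hpos := sub_sq_pos_of_lt_sqrt h1 h2
    have hsp := Real.sqrt_pos.mpr hpos
    rw [integral_sub (hint (by fun_prop)) (hint (by fun_prop)), setIntegral_const,
      smul_eq_mul] at hM
    have hz : (∫ p in cutParaboloid a X, p).2.2 = ∫ p in cutParaboloid a X, p.2.2 := by
      rw [snd_integral (f := fun p => p) (hint continuous_id),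
        snd_integral (f := fun p : ℝ × ℝ × ℝ => p.2) (hint continuous_snd)]
    rw [hB₁, Prod.smul_snd, Prod.smul_snd, hz, smul_eq_mul, ← Measure.real,
      inv_mul_eq_iff_eq_mul₀ hV.ne', ← sub_eq_zero, hM]
    have hne : (a - X ^ 2) ^ 2 * √(a - X ^ 2) ≠ 0 := by positivity
    rw [mul_eq_zero_iff_right hne]
    simp
  · rintro rfl
    exact volume_real_cutParaboloid_zero ha
end

section
/- Let a > 0 and consider the quadratic form Q(x,y) = (2a^{3/2}/3)·x² + (4a^{5/2}/15)·x·y + (4a^{7/2}/105 − a^{5/2}/30)·y² on ℝ². Then Q is positive definite if and only if a > 35/12, and if a < 35/12 then Q is indefinite (it takes both positive and negative values). -/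
open Real

/-- The floating paraboloid form with its square completed. -/
theorem paraboloid_form_eq_completed_square {a : ℝ} (ha : 0 < a) (x y : ℝ) :
    2 * a ^ ((3 : ℝ) / 2) / 3 * x ^ 2 + 4 * a ^ ((5 : ℝ) / 2) / 15 * x * y +
        (4 * a ^ ((7 : ℝ) / 2) / 105 - a ^ ((5 : ℝ) / 2) / 30) * y ^ 2 =
      a ^ ((3 : ℝ) / 2) *
        (2 / 3 * (x + a / 5 * y) ^ 2 + 2 * a / 175 * (a - 35 / 12) * y ^ 2) := by
  have h5 : a ^ ((5 : ℝ) / 2) = a ^ ((3 : ℝ) / 2) * a := by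
    rw [← rpow_add_one ha.ne']
    norm_num
  have h7 : a ^ ((7 : ℝ) / 2) = a ^ ((5 : ℝ) / 2) * a := by
    rw [← rpow_add_one ha.ne']
    norm_num
  rw [h7, h5]
  ring

theorem stmt_19 (a : ℝ) (ha : 0 < a)
    (Q : ℝ → ℝ → ℝ)
    (hQ : ∀ x y, Q x y = 2 * a ^ ((3 : ℝ) / 2) / 3 * x ^ 2 +
        4 * a ^ ((5 : ℝ) / 2) / 15 * x * y +
        (4 * a ^ ((7 : ℝ) / 2) / 105 - a ^ ((5 : ℝ) / 2) / 30) * y ^ 2) :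
    ((∀ x y : ℝ, (x, y) ≠ ((0 : ℝ), (0 : ℝ)) → 0 < Q x y) ↔ 35 / 12 < a) ∧
    (a < 35 / 12 → (∃ x y : ℝ, 0 < Q x y) ∧ (∃ x y : ℝ, Q x y < 0)) := by
  simp only [paraboloid_form_eq_completed_square ha] at hQ
  have hs : 0 < a ^ ((3 : ℝ) / 2) := rpow_pos_of_pos ha _
  have hc : 0 < a ^ ((3 : ℝ) / 2) * (2 * a / 175) := by positivity
  have hmin : Q (-(a / 5)) 1 = a ^ ((3 : ℝ) / 2) * (2 * a / 175) * (a - 35 / 12) := by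
    rw [hQ]
    ring
  refine ⟨⟨fun h => ?_, fun h x y hxy => ?_⟩, fun h => ⟨⟨1, 0, ?_⟩, -(a / 5), 1, ?_⟩⟩
  · have hpos := h (-(a / 5)) 1 (by simp)
    rw [hmin] at hpos
    exact sub_pos.mp (pos_of_mul_pos_right hpos hc.le)
  · have hd : 0 < a - 35 / 12 := sub_pos.mpr h
    rw [hQ]
    apply mul_pos hs
    rcases eq_or_ne y 0 with rfl | hy
    · have hx : x ≠ 0 := by simpa using hxy
      simp only [mul_zero, add_zero, ne_eq, OfNat.ofNat_ne_zero, not_false_eq_true, zero_pow]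
      positivity
    · positivity
  · rw [hQ]
    simp only [mul_zero, add_zero, ne_eq, OfNat.ofNat_ne_zero, not_false_eq_true, zero_pow]
    positivity
  · rw [hmin]
    exact mul_neg_of_pos_of_neg hc (sub_neg.mpr h)
end
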